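/- Let B be a finite set with a transitive right action of SL(2,ℤ), and for each b ∈ B let f_b be a modular form of weight k and level N such that for all γ ∈ SL(2,ℤ), f_b|_k γ = c_{b,γ} · f_{bγ} for some nonzero constant c_{b,γ}. If the sum over b ∈ B of the vanishing orders ord(f_b) at infinity exceeds (1/12)·k·#B, then f_b = 0 for all b ∈ B. -/

import Mathlib

noncomputable section
open Matrix Complex
open scoped MatrixGroups

abbrev SL2Z := Matrix.SpecialLinearGroup (Fin 2) ℤ

/-- The weight-`k` slash action on functions on the upper half plane. -/
def eslash (k : ℤ) (f : UpperHalfPlane → ℂ) (γ : SL2Z) : UpperHalfPlane → ℂ :=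
  fun τ => (((γ 1 0 : ℤ) : ℂ) * (τ : ℂ) + ((γ 1 1 : ℤ) : ℂ)) ^ (-k) * f (γ • τ)

open UpperHalfPlane ModularForm Filter Topology in
open scoped Manifold in
/-- A bounded level one invariant function which tends to zero at infinity is zero. -/
lemma aux_levelOne (h : UpperHalfPlane → ℂ) (hd : MDiff h)
    (hinv : ∀ (γ : SL2Z) (τ : UpperHalfPlane), h (γ • τ) = h τ)
    (h0 : IsZeroAtImInfty h) : h = 0 := by
  have hs : ∀ γ : SL2Z, h ∣[(0 : ℤ)] γ = h := by
    intro γ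
    ext τ
    rw [ModularForm.SL_slash_apply, hinv]
    simp
  let H : ModularForm 𝒮ℒ 0 :=
    { toFun := h
      slash_action_eq' := fun _ ⟨γ, hγ⟩ ↦ hγ ▸ hs γ
      holo' := hd
      bdd_at_cusps' := by
        intro c hc
        rw [Subgroup.IsArithmetic.isCusp_iff_isCusp_SL2Z] at hc
        rw [OnePoint.isBoundedAt_iff_forall_SL2Z hc]
        intro γ _
        rw [hs γ]
        exact h0.boundedAtFilter }
  obtain ⟨c, hc⟩ := ModularFormClass.levelOne_weight_zero_const H
  have hc' : h = Function.const _ c := hc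
  have : c = 0 := by
    have h1 : Tendsto h atImInfty (𝓝 0) := h0
    rw [hc'] at h1
    exact tendsto_nhds_unique tendsto_const_nhds h1
  rw [hc', this]
  rfl

lemma aux_norm_term (a : ℂ) (j : ℤ) (N : ℕ) (τ : UpperHalfPlane) :
    ‖a * Complex.exp (2 * Real.pi * Complex.I * ((j : ℂ) / N) * (τ : ℂ))‖
      = ‖a‖ * Real.exp (-2 * Real.pi * ((j : ℝ) / N) * τ.im) := by
  rw [norm_mul, Complex.norm_exp]
  congr 2
  have : (2 * Real.pi * Complex.I * ((j : ℂ) / N) * (τ : ℂ))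
      = ((2 * Real.pi * ((j : ℝ) / N) : ℝ) : ℂ) * (Complex.I * (τ : ℂ)) := by
    push_cast; ring
  rw [this, Complex.re_ofReal_mul]
  simp

lemma aux_series (a : ℤ → ℂ) (N : ℕ) (ν : ℚ)
    (hν : ∀ j : ℤ, (j : ℚ) / N < ν → a j = 0) (τ₀ : UpperHalfPlane)
    (hs : Summable fun j : ℤ => a j *
        Complex.exp (2 * Real.pi * Complex.I * ((j : ℂ) / N) * (τ₀ : ℂ))) :
    ∃ A : ℝ, ∀ τ : UpperHalfPlane, τ₀.im ≤ τ.im →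
      (Summable fun j : ℤ => a j *
        Complex.exp (2 * Real.pi * Complex.I * ((j : ℂ) / N) * (τ : ℂ))) ∧
      ‖∑' j : ℤ, a j * Complex.exp (2 * Real.pi * Complex.I * ((j : ℂ) / N) * (τ : ℂ))‖
        ≤ A * Real.exp (-2 * Real.pi * ν * τ.im) := by
  have hs' := hs.norm
  simp_rw [aux_norm_term] at hs'
  refine ⟨(∑' j : ℤ, ‖a j‖ * Real.exp (-2 * Real.pi * ((j : ℝ) / N) * τ₀.im))
    * Real.exp (2 * Real.pi * ν * τ₀.im), fun τ hτ => ?_⟩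
  have key : ∀ j : ℤ, ‖a j * Complex.exp (2 * Real.pi * Complex.I * ((j : ℂ) / N) * (τ : ℂ))‖
      ≤ (‖a j‖ * Real.exp (-2 * Real.pi * ((j : ℝ) / N) * τ₀.im))
        * Real.exp (-2 * Real.pi * ν * (τ.im - τ₀.im)) := by
    intro j
    rw [aux_norm_term, mul_assoc ‖a j‖, ← Real.exp_add]
    rcases lt_or_ge ((j : ℚ) / N) ν with h | h
    · simp [hν j h]
    · have h' : (ν : ℝ) ≤ (j : ℝ) / N := by exact_mod_cast h
      gcongr
      have := mul_nonneg (mul_nonneg Real.pi_pos.le (sub_nonneg.2 h')) (sub_nonneg.2 hτ)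
      nlinarith
  have hsum := hs'.mul_right (Real.exp (-2 * Real.pi * ν * (τ.im - τ₀.im)))
  have hsn := Summable.of_nonneg_of_le (fun _ => norm_nonneg _) key hsum
  refine ⟨hsn.of_norm, (norm_tsum_le_tsum_norm hsn).trans ((hsn.tsum_le_tsum key hsum).trans ?_)⟩
  rw [tsum_mul_right, mul_assoc (tsum _), ← Real.exp_add]
  apply le_of_eq
  congr 2
  ring

open UpperHalfPlane Filter Topology in
open scoped Manifold in
/-- If the series fails to be summable somewhere, then the function is zero. -/
lemma aux_summable (g : UpperHalfPlane → ℂ) (hd : MDiff g) (a : ℤ → ℂ) (N : ℕ) (ν : ℚ)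
    (hν : ∀ j : ℤ, (j : ℚ) / N < ν → a j = 0)
    (hexp : ∀ τ : UpperHalfPlane, g τ = ∑' j : ℤ, a j *
        Complex.exp (2 * Real.pi * Complex.I * ((j : ℂ) / N) * (τ : ℂ)))
    (hg : g ≠ 0) (τ₀ : UpperHalfPlane) :
    Summable fun j : ℤ => a j *
        Complex.exp (2 * Real.pi * Complex.I * ((j : ℂ) / N) * (τ₀ : ℂ)) := by
  by_contra hns
  apply hg
  have hz : ∀ τ : UpperHalfPlane, τ.im ≤ τ₀.im → g τ = 0 := by
    intro τ hτ
    rw [hexp]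
    apply tsum_eq_zero_of_not_summable
    intro hs
    obtain ⟨A, hA⟩ := aux_series a N ν hν τ hs
    exact hns (hA τ₀ hτ).1
  let τ₁ : UpperHalfPlane := ⟨Complex.I * ((τ₀.im / 2 : ℝ) : ℂ), by
    have := τ₀.im_pos
    simp; linarith⟩
  have h1 : τ₁.im < τ₀.im := by
    have : τ₁.im = τ₀.im / 2 := by
      change (Complex.I * ((τ₀.im / 2 : ℝ) : ℂ)).im = _
      simp
    have := τ₀.im_pos
    linarith
  refine UpperHalfPlane.eq_zero_of_frequently hd (τ := τ₁) (Eventually.frequently ?_)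
  apply eventually_nhdsWithin_of_eventually_nhds
  have : ∀ᶠ z : UpperHalfPlane in 𝓝 τ₁, z.im < τ₀.im :=
    UpperHalfPlane.continuous_im.continuousAt.eventually (gt_mem_nhds h1)
  filter_upwards [this] with z hz' using hz z hz'.le

open UpperHalfPlane ModularForm Filter Topology in
open scoped Manifold in
lemma aux_h_mdiff (F : UpperHalfPlane → ℂ) (hF : MDiff F) (K : ℤ) (M : ℕ) :
    MDiff (fun τ => (F τ ^ 12 * discriminant τ ^ (-K)) ^ M) := by
  rw [UpperHalfPlane.mdifferentiable_iff] at hF ⊢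
  have hD := UpperHalfPlane.mdifferentiable_iff.1 CuspForm.discriminant.holo'
  have hD' : DifferentiableOn ℂ (discriminant ∘ ofComplex) {z : ℂ | 0 < z.im} := hD
  have h2 := ((hF.pow 12).mul (hD'.zpow (m := -K)
    (Or.inl fun z _ => discriminant_ne_zero _))).pow M
  exact h2

open UpperHalfPlane ModularForm Filter Topology in
lemma aux_h_zero (F : UpperHalfPlane → ℂ) (K : ℤ) (μ A : ℝ) (hμ : (K : ℝ) < 12 * μ)
    (hF : ∀ᶠ τ in atImInfty, ‖F τ‖ ≤ A * Real.exp (-2 * Real.pi * μ * τ.im)) :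
    IsZeroAtImInfty (fun τ => F τ ^ 12 * discriminant τ ^ (-K)) := by
  have hP := tendsto_atImInfty_tprod_one_sub_eta_q_pow
  have hP' := hP.zpow₀ (-K) (Or.inl one_ne_zero)
  rw [_root_.one_zpow] at hP'
  have h1 : Tendsto (fun τ : ℍ => F τ ^ 12 * Function.Periodic.qParam 1 τ ^ (-K))
      atImInfty (𝓝 0) := by
    have hb : Tendsto (fun τ : ℍ => A ^ 12 * Real.exp (-(2 * Real.pi * (12 * μ - K)) * τ.im))
        atImInfty (𝓝 0) := by
      rw [← mul_zero (A ^ 12)]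
      refine Tendsto.const_mul _ (Real.tendsto_exp_atBot.comp ?_)
      refine Tendsto.const_mul_atTop_of_neg ?_ tendsto_comap
      have := Real.pi_pos
      nlinarith [mul_pos Real.pi_pos (sub_pos.2 hμ)]
    refine squeeze_zero_norm' ?_ hb
    filter_upwards [hF] with τ hτ
    have hq : ‖Function.Periodic.qParam 1 τ‖ = Real.exp (-2 * Real.pi * τ.im) := by
      simp [Function.Periodic.qParam, Complex.norm_exp]
    rw [norm_mul, norm_pow, norm_zpow, hq]
    calc ‖F τ‖ ^ 12 * Real.exp (-2 * Real.pi * τ.im) ^ (-K)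
        ≤ (A * Real.exp (-2 * Real.pi * μ * τ.im)) ^ 12 * Real.exp (-2 * Real.pi * τ.im) ^ (-K) := by
          gcongr
      _ = _ := by
          rw [mul_pow, mul_assoc, ← Real.exp_nat_mul, ← Real.rpow_intCast,
            ← Real.exp_mul, ← Real.exp_add]
          congr 2
          push_cast
          ring
  have h2 := h1.mul hP'
  rw [zero_mul] at h2
  refine h2.congr fun τ => ?_
  rw [discriminant_eq_q_prod, mul_zpow, mul_assoc]

/-- Let `B` be a finite set with a transitive right `SL(2,ℤ)`-action and `f b`
modular forms of weight `k` and level `N` with `f b ∣ₖ γ = c(b,γ) · f (bγ)` for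
nonzero constants `c(b,γ)`. If the sum over `b` of the vanishing orders of
`f b` at infinity exceeds `k·#B/12`, then all `f b` vanish. The vanishing
orders are encoded by Fourier expansions `f b = Σ coeff b j · e(jτ/N)` whose
coefficients vanish below `ν b`. -/
theorem stmt0 {B : Type} [Fintype B] (act : B → SL2Z → B)
    (act_one : ∀ b, act b 1 = b)
    (act_mul : ∀ b γ δ, act b (γ * δ) = act (act b γ) δ)
    (act_trans : ∀ b b', ∃ γ, act b γ = b')
    (k : ℤ) (N : ℕ) (hN : 0 < N)
    (f : B → ModularForm (CongruenceSubgroup.Gamma N) k)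
    (c : B → SL2Z → ℂ) (hc : ∀ b γ, c b γ ≠ 0)
    (hslash : ∀ b γ, eslash k (⇑(f b)) γ = fun τ => c b γ * f (act b γ) τ)
    (coeff : B → ℤ → ℂ)
    (hexp : ∀ b (τ : UpperHalfPlane), f b τ =
      ∑' j : ℤ, coeff b j *
        Complex.exp (2 * Real.pi * Complex.I * ((j : ℂ) / N) * (τ : ℂ)))
    (ν : B → ℚ)
    (hν : ∀ b (j : ℤ), (j : ℚ) / N < ν b → coeff b j = 0)
    (hsum : (1 / 12 : ℚ) * k * (Fintype.card B) < ∑ b, ν b) :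
    ∀ b, f b = 0 := by
  classical
  -- transformation of `f b`
  have hden : ∀ (γ : SL2Z) (τ : UpperHalfPlane), UpperHalfPlane.denom γ τ
      = ((γ 1 0 : ℤ) : ℂ) * (τ : ℂ) + ((γ 1 1 : ℤ) : ℂ) := by
    intro γ τ
    simp [UpperHalfPlane.denom]
  have htr : ∀ b (γ : SL2Z) (τ : UpperHalfPlane),
      f b (γ • τ) = UpperHalfPlane.denom γ τ ^ k * (c b γ * f (act b γ) τ) := by
    intro b γ τ
    have h1 := congrFun (hslash b γ) τ
    simp only [eslash] at h1
    rw [← hden] at h1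
    have hne : UpperHalfPlane.denom γ τ ≠ 0 := UpperHalfPlane.denom_ne_zero _ _
    rw [← h1, ← mul_assoc, ← zpow_add₀ hne]
    simp
  -- one zero implies all zero
  have hall : (∃ b, f b = 0) → ∀ b, f b = 0 := by
    rintro ⟨b, hb⟩ b'
    obtain ⟨γ, rfl⟩ := act_trans b b'
    ext τ
    have h1 := htr b γ τ
    have hne : UpperHalfPlane.denom γ τ ≠ 0 := UpperHalfPlane.denom_ne_zero _ _
    rw [hb] at h1
    have h2 : (0 : ℂ) = _ := h1
    have h3 := (mul_eq_zero.1 h2.symm).resolve_left (zpow_ne_zero _ hne)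
    exact (mul_eq_zero.1 h3).resolve_left (hc _ _)
  by_contra hcon
  have hnz : ∀ b, f b ≠ 0 := fun b hb => hcon (hall ⟨b, hb⟩)
  have hnz' : ∀ b, (f b : UpperHalfPlane → ℂ) ≠ 0 := fun b hb =>
    hnz b (DFunLike.coe_injective hb)
  have hbd : ∀ b, ∃ A : ℝ, ∀ τ : UpperHalfPlane, UpperHalfPlane.I.im ≤ τ.im →
      ‖f b τ‖ ≤ A * Real.exp (-2 * Real.pi * ν b * τ.im) := by
    intro b
    obtain ⟨A, hA⟩ := aux_series (coeff b) N (ν b) (hν b) UpperHalfPlane.I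
      (aux_summable (f b) (f b).holo' (coeff b) N (ν b) (hν b) (hexp b) (hnz' b) _)
    exact ⟨A, fun τ hτ => by rw [hexp]; exact (hA τ hτ).2⟩
  choose A hA using hbd
  set K : ℤ := k * Fintype.card B with hK
  let F : UpperHalfPlane → ℂ := ∏ b, (f b : UpperHalfPlane → ℂ)
  have hFa : ∀ τ, F τ = ∏ b, f b τ := fun τ => by simp [F]
  have hFd := UpperHalfPlane.prod_eq_zero_iff (s := Finset.univ)
    (f := fun b => (f b : UpperHalfPlane → ℂ)) (fun b _ => (f b).holo')
  have hF0 : F ≠ 0 := by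
    intro h
    obtain ⟨b, -, hb⟩ := hFd.1 h
    exact hnz' b hb
  let h : UpperHalfPlane → ℂ := fun τ => F τ ^ 12 * ModularForm.discriminant τ ^ (-K)
  have : NeZero N := ⟨hN.ne'⟩
  let M : ℕ := (CongruenceSubgroup.Gamma N).index
  have hM : M ≠ 0 := Subgroup.FiniteIndex.index_ne_zero
  have hDtr : ∀ (γ : SL2Z) (τ : UpperHalfPlane), ModularForm.discriminant (γ • τ)
      = UpperHalfPlane.denom γ τ ^ (12 : ℤ) * ModularForm.discriminant τ := fun γ τ =>
    SlashInvariantForm.slash_action_eqn'' (Γ := 𝒮ℒ) CuspForm.discriminant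
      (γ := (γ : GL (Fin 2) ℝ)) ⟨γ, rfl⟩ τ
  have hgen : ∀ (γ : SL2Z) (τ : UpperHalfPlane) (C : ℂ),
      F (γ • τ) = UpperHalfPlane.denom γ τ ^ K * (C * F τ) → h (γ • τ) = C ^ 12 * h τ := by
    intro γ τ C hC
    have hne : UpperHalfPlane.denom γ τ ≠ 0 := UpperHalfPlane.denom_ne_zero _ _
    simp only [h]
    rw [hC, hDtr, mul_pow, mul_pow, mul_zpow, ← zpow_natCast (_ ^ K) 12, ← _root_.zpow_mul, ← _root_.zpow_mul]
    have : UpperHalfPlane.denom γ τ ^ (K * ((12 : ℕ) : ℤ)) * UpperHalfPlane.denom γ τ ^ (12 * -K)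
        = 1 := by
      rw [← zpow_add₀ hne]
      convert zpow_zero _ using 2
      push_cast; ring
    linear_combination (C ^ 12 * F τ ^ 12 * ModularForm.discriminant τ ^ (-K)) * this
  have hχ : ∀ (γ : SL2Z), ∃ C : ℂ, ∀ τ, h (γ • τ) = C * h τ := by
    intro γ
    refine ⟨(∏ b, c b γ) ^ 12, fun τ => hgen γ τ _ ?_⟩
    have hbij : Function.Bijective (fun b => act b γ) := by
      refine ⟨fun b b' hb => ?_, fun b => ⟨act b γ⁻¹, ?_⟩⟩
      · have := congrArg (fun x => act x γ⁻¹) hb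
        simpa [← act_mul, act_one] using this
      · simp [← act_mul, act_one]
    have hre : ∏ b, f (act b γ) τ = ∏ b, f b τ :=
      hbij.prod_comp (fun b => f b τ)
    rw [hFa, hFa, Finset.prod_congr rfl fun b _ => htr b γ τ, Finset.prod_mul_distrib,
      Finset.prod_mul_distrib, hre, Finset.prod_const, Finset.card_univ, hK, _root_.zpow_mul, zpow_natCast]
  have hΓ : ∀ γ ∈ CongruenceSubgroup.Gamma N, ∀ τ, h (γ • τ) = h τ := by
    intro γ hγ τ
    rw [hgen γ τ 1, one_pow, one_mul]
    rw [hFa, hFa, Finset.prod_congr rfl fun b _ =>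
      SlashInvariantForm.slash_action_eqn_SL'' (f b) hγ τ, Finset.prod_mul_distrib,
      Finset.prod_const, Finset.card_univ, hK, _root_.zpow_mul, zpow_natCast, one_mul]
  have hH : (fun τ => h τ ^ M) = 0 := by
    have hFmd : MDifferentiable (modelWithCornersSelf ℂ ℂ) (modelWithCornersSelf ℂ ℂ) F :=
      .prod fun b _ => (f b).holo'
    refine aux_levelOne _ (aux_h_mdiff F hFmd K M) ?_ ?_
    · intro γ τ
      obtain ⟨C, hC⟩ := hχ γ
      have hpow : ∀ n : ℕ, h (γ ^ n • τ) = C ^ n * h τ := by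
        intro n
        induction n with
        | zero => simp
        | succ n ih => rw [pow_succ', mul_smul, hC, ih]; ring
      have := CongruenceSubgroup.Gamma_normal N
      have h1 := hΓ _ (Subgroup.pow_index_mem (CongruenceSubgroup.Gamma N) γ) τ
      have h2 := hpow M
      rw [h1] at h2
      rw [hC, mul_pow]
      obtain ⟨m, hm⟩ := Nat.exists_eq_succ_of_ne_zero hM
      rw [hm, Nat.succ_eq_add_one] at h2 ⊢
      linear_combination (-h τ ^ m) * h2
    · have hz : UpperHalfPlane.IsZeroAtImInfty h := by
        refine aux_h_zero F K ((∑ b, ν b : ℚ) : ℝ) (∏ b, A b) ?_ ?_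
        · have : (K : ℚ) < 12 * ∑ b, ν b := by
            rw [hK]; push_cast; linarith
          exact_mod_cast this
        · rw [Filter.Eventually, UpperHalfPlane.atImInfty_mem]
          refine ⟨UpperHalfPlane.I.im, fun τ hτ => ?_⟩
          change ‖F τ‖ ≤ _
          rw [hFa, norm_prod]
          refine (Finset.prod_le_prod (fun _ _ => norm_nonneg _) fun b _ => hA b τ hτ).trans ?_
          rw [Finset.prod_mul_distrib, ← Real.exp_sum]
          apply le_of_eq
          congr 2
          push_cast
          rw [Finset.mul_sum, Finset.sum_mul]
      have hz' : Filter.Tendsto h UpperHalfPlane.atImInfty (nhds 0) := hz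
      have := hz'.pow M
      rw [zero_pow hM] at this
      exact this
  apply hF0
  ext τ
  have h1 : h τ ^ M = 0 := congrFun hH τ
  have h2 : F τ ^ 12 * ModularForm.discriminant τ ^ (-K) = 0 := pow_eq_zero_iff hM |>.1 h1
  have h3 := (mul_eq_zero.1 h2).resolve_right
    (zpow_ne_zero _ (ModularForm.discriminant_ne_zero τ))
  exact pow_eq_zero_iff (by norm_num) |>.1 h3
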